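/- arXiv:math/0304363 — 7 statements merged into one kernel-verified Lean document; each statement's English description precedes it below -/
import Mathlib

section
/- For all multisets α and β of natural numbers and every natural number i, the sum of the i largest elements of the multiset union α + β equals the maximum, over all j with 0 ≤ j ≤ i, of (the sum of the j largest elements of α) + (the sum of the (i−j) largest elements of β); that is, σ_i(α + β) = max_{0 ≤ j ≤ i} (σ_j(α) + σ_{i−j}(β)). -/
/-- `sigmaTop μ i` is the sum of the `i` largest elements of the multiset `μ`
of natural numbers (counted with multiplicity). -/
def sigmaTop (μ : Multiset ℕ) (i : ℕ) : ℕ :=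
  ((μ.sort (· ≤ ·)).reverse.take i).sum

/-- In a list sorted in decreasing order, the initial segment of length `i` has the largest sum
among all sublists of length at most `i`. -/
theorem List.Sublist.sum_le_sum_take {l L : List ℕ} (h : l.Sublist L)
    (hL : L.Pairwise (· ≥ ·)) {i : ℕ} (hi : l.length ≤ i) : l.sum ≤ (L.take i).sum := by
  induction L generalizing l i with
  | nil => simp [List.sublist_nil.mp h]
  | cons a L ih =>
    obtain ⟨ha, hL⟩ := List.pairwise_cons.mp hL
    cases l with
    | nil => simp
    | cons b l =>
      obtain ⟨k, rfl⟩ : ∃ k, i = k + 1 := Nat.exists_eq_add_one.mpr (by simp at hi; omega)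
      have hb : b ≤ a := by
        rcases List.mem_cons.mp (h.subset List.mem_cons_self) with hb | hb
        · exact hb.le
        · exact ha b hb
      have hl := ih h.tail hL (i := k) (by simpa using hi)
      simp only [List.tail_cons] at hl
      simpa using add_le_add hb hl

theorem sum_le_sigmaTop {s μ : Multiset ℕ} (h : s ≤ μ) {i : ℕ} (hi : s.card ≤ i) :
    s.sum ≤ sigmaTop μ i := by
  have hμ : (((μ.sort (· ≤ ·)).reverse : List ℕ) : Multiset ℕ) = μ := by simp
  induction s using Quotient.inductionOn with
  | h l =>
    rw [← hμ] at h
    obtain ⟨l', hl', hsub⟩ := Multiset.coe_le.mp h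
    have hle := hsub.sum_le_sum_take (i := i)
      (List.pairwise_reverse.mpr (Multiset.pairwise_sort μ (· ≤ ·)))
      (by simpa [hl'.length_eq] using hi)
    simpa [sigmaTop, hl'.sum_eq] using hle

theorem exists_le_sum_eq_sigmaTop (μ : Multiset ℕ) (i : ℕ) :
    ∃ s ≤ μ, s.card ≤ i ∧ s.sum = sigmaTop μ i := by
  refine ⟨((μ.sort (· ≤ ·)).reverse.take i : List ℕ), ?_, by simp, by simp [sigmaTop]⟩
  calc (((μ.sort (· ≤ ·)).reverse.take i : List ℕ) : Multiset ℕ)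
      ≤ ((μ.sort (· ≤ ·)).reverse : List ℕ) :=
        Multiset.coe_le.mpr (List.take_sublist _ _).subperm
    _ = μ := by simp

/-- σ_i(α + β) = max_{0 ≤ j ≤ i} (σ_j(α) + σ_{i−j}(β)). -/
theorem sigmaTop_add (α β : Multiset ℕ) (i : ℕ) :
    sigmaTop (α + β) i =
      (Finset.range (i + 1)).sup (fun j => sigmaTop α j + sigmaTop β (i - j)) := by
  apply le_antisymm
  · obtain ⟨s, hs, hcard, hsum⟩ := exists_le_sum_eq_sigmaTop (α + β) i
    have hsplit : s - α + s ∩ α = s := Multiset.sub_add_inter s α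
    have hc : (s - α).card + (s ∩ α).card = s.card := by
      rw [← Multiset.card_add, hsplit]
    have hβ : s - α ≤ β := Multiset.sub_le_iff_le_add'.mpr hs
    calc sigmaTop (α + β) i = (s ∩ α).sum + (s - α).sum := by
          rw [← hsum, add_comm, ← Multiset.sum_add, hsplit]
      _ ≤ sigmaTop α (s ∩ α).card + sigmaTop β (i - (s ∩ α).card) :=
          add_le_add (sum_le_sigmaTop Multiset.inter_le_right le_rfl)
            (sum_le_sigmaTop hβ (by omega))
      _ ≤ _ := Finset.le_sup (f := fun j => sigmaTop α j + sigmaTop β (i - j))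
          (Finset.mem_range.mpr (by omega))
  · refine Finset.sup_le fun j hj => ?_
    have hj := Finset.mem_range.mp hj
    obtain ⟨s, hs, hsc, hss⟩ := exists_le_sum_eq_sigmaTop α j
    obtain ⟨t, ht, htc, hts⟩ := exists_le_sum_eq_sigmaTop β (i - j)
    rw [← hss, ← hts, ← Multiset.sum_add]
    exact sum_le_sigmaTop (add_le_add hs ht) (by rw [Multiset.card_add]; omega)
end

section
/- Let α, α', β, β' be multisets of natural numbers such that σ_i(α) ≤ σ_i(α') and σ_i(β) ≤ σ_i(β') for every natural number i. Then σ_i(α + β) ≤ σ_i(α' + β') for every i. (In other words, the dominance preorder on multisets of naturals is monotone under multiset union; this is the fact used in the paper to deduce λ̄ ≤ λ̄' from ξ ≤ ξ' and η ≤ η' in Lemme 3.6.) -/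
theorem List.Sublist.sum_le_sum_take_of_pairwise_ge {s l : List ℕ} {i : ℕ}
    (hs : s.Sublist l) (hl : l.Pairwise (· ≥ ·)) (hi : s.length ≤ i) :
    s.sum ≤ (l.take i).sum := by
  induction l generalizing s i with
  | nil => simp [List.sublist_nil.mp hs]
  | cons a l ih =>
    rcases s with _ | ⟨b, s⟩
    · simp
    obtain ⟨k, rfl⟩ : ∃ k, i = k + 1 := ⟨i - 1, by simp at hi; omega⟩
    have hb : b ≤ a := by
      rcases List.mem_cons.mp (hs.subset List.mem_cons_self) with rfl | h
      · exact le_rfl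
      · exact List.rel_of_pairwise_cons hl h
    have hsl : s.Sublist l := hs.tail
    have := ih hsl hl.of_cons (i := k) (by simpa using hi)
    simpa using add_le_add hb this

theorem sum_le_sigmaTop_s1 {μ t : Multiset ℕ} {i : ℕ} (ht : t ≤ μ) (hi : t.card ≤ i) :
    t.sum ≤ sigmaTop μ i := by
  have hμ : (((μ.sort (· ≤ ·)).reverse : List ℕ) : Multiset ℕ) = μ := by simp
  rw [← hμ] at ht
  induction t using Quotient.inductionOn with
  | h s =>
    obtain ⟨s', hperm, hsub⟩ := Multiset.coe_le.mp ht
    have hsum := hsub.sum_le_sum_take_of_pairwise_ge (i := i)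
      (List.pairwise_reverse.mpr (Multiset.pairwise_sort μ (· ≤ ·)))
      (by simpa [hperm.length_eq] using hi)
    simpa [sigmaTop, hperm.sum_eq] using hsum

theorem exists_le_card_le_sum_eq_sigmaTop (μ : Multiset ℕ) (i : ℕ) :
    ∃ t ≤ μ, t.card ≤ i ∧ t.sum = sigmaTop μ i := by
  refine ⟨((μ.sort (· ≤ ·)).reverse.take i : List ℕ), ?_, ?_, ?_⟩
  · calc (((μ.sort (· ≤ ·)).reverse.take i : List ℕ) : Multiset ℕ)
        ≤ ((μ.sort (· ≤ ·)).reverse : List ℕ) :=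
          Multiset.coe_le.mpr (List.take_sublist _ _).subperm
      _ = μ := by simp
  · rw [Multiset.coe_card]
    exact List.length_take_le _ _
  · simp [sigmaTop]

/-- The dominance preorder on multisets of naturals is monotone under
multiset union: if σ_i(α) ≤ σ_i(α') and σ_i(β) ≤ σ_i(β') for every i, then
σ_i(α + β) ≤ σ_i(α' + β') for every i. -/
theorem sigmaTop_add_le_add (α α' β β' : Multiset ℕ)
    (hα : ∀ i, sigmaTop α i ≤ sigmaTop α' i)
    (hβ : ∀ i, sigmaTop β i ≤ sigmaTop β' i) :
    ∀ i, sigmaTop (α + β) i ≤ sigmaTop (α' + β') i := by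
  intro i
  obtain ⟨t, ht, hti, hsum⟩ := exists_le_card_le_sum_eq_sigmaTop (α + β) i
  have hsplit : t - α + t ∩ α = t := Multiset.sub_add_inter t α
  obtain ⟨a, ha, hacard, hasum⟩ := exists_le_card_le_sum_eq_sigmaTop α' (t ∩ α).card
  obtain ⟨b, hb, hbcard, hbsum⟩ := exists_le_card_le_sum_eq_sigmaTop β' (t - α).card
  have hcard : (t - α).card + (t ∩ α).card = t.card := by
    rw [← Multiset.card_add, hsplit]
  calc sigmaTop (α + β) i = (t ∩ α).sum + (t - α).sum := by
        rw [← hsum, add_comm, ← Multiset.sum_add, hsplit]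
    _ ≤ sigmaTop α (t ∩ α).card + sigmaTop β (t - α).card :=
        add_le_add (sum_le_sigmaTop_s1 Multiset.inter_le_right le_rfl)
          (sum_le_sigmaTop_s1 (Multiset.sub_le_iff_le_add'.mpr ht) le_rfl)
    _ ≤ sigmaTop α' (t ∩ α).card + sigmaTop β' (t - α).card := add_le_add (hα _) (hβ _)
    _ = (a + b).sum := by rw [Multiset.sum_add, hasum, hbsum]
    _ ≤ sigmaTop (α' + β') i :=
        sum_le_sigmaTop_s1 (add_le_add ha hb) (by rw [Multiset.card_add]; omega)
end

section
/- Let m be a natural number and let λ : Fin (2m+1) → ℕ be monotone such that every even natural number occurs an even number of times among the values of λ (counted with multiplicity). Then the map λ̄ : Fin (2m+1) → ℕ defined by λ̄ i = λ i + i is strictly increasing and exactly m of its values are even (hence exactly m+1 of its values are odd). (This is the paper's claim, in the type B construction of u-symbols, that the list η* of even parts of λ̄ has exactly m entries.) -/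
/-- The multiset of values of a function on `Fin k`. -/
def mvals {k : ℕ} (f : Fin k → ℕ) : Multiset ℕ :=
  Multiset.map f Finset.univ.val

/-- If every even number occurs an even number of times among the first `k` values of `f`,
and `f` is monotone there, then exactly `k / 2` of the numbers `f i + i` with `i < k` are even. -/
theorem count_even_add_self_eq_half (f : ℕ → ℕ) (k : ℕ)
    (hmono : ∀ i j, i ≤ j → j < k → f i ≤ f j)
    (hadm : ∀ n, Even n → Even (Nat.count (fun i => f i = n) k)) :
    Nat.count (fun i => Even (f i + i)) k = k / 2 := by
  induction k using Nat.strong_induction_on with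
  | _ k ih =>
  rcases k with _ | k
  · simp
  by_cases hk : Even (f k)
  · obtain ⟨l, rfl, hl⟩ : ∃ l, k = l + 1 ∧ f l = f k := by
      by_contra! hne
      have hzero : Nat.count (fun i => f i = f k) k = 0 := by
        rw [Nat.count_eq_card_filter_range, Finset.card_eq_zero, Finset.filter_eq_empty_iff]
        intro i hi heq
        rw [Finset.mem_range] at hi
        have h₁ := hmono i (k - 1) (by omega) (by omega)
        have h₂ := hmono (k - 1) k (by omega) (by omega)
        exact hne (k - 1) (by omega) (by omega)
      simpa [Nat.count_succ, hzero] using hadm (f k) hk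
    have hcount := ih l (by omega) (fun i j hij hj => hmono i j hij (by omega)) fun n hn => by
      have h := hadm n hn
      rw [Nat.count_succ, Nat.count_succ, hl] at h
      split_ifs at h <;> grind
    rw [Nat.count_succ, Nat.count_succ, hcount, hl]
    split_ifs <;> grind
  · have hcount := ih k (by omega) (fun i j hij hj => hmono i j hij (by omega)) fun n hn => by
      have h := hadm n hn
      rwa [Nat.count_succ, if_neg (by rintro rfl; exact hk hn), add_zero] at h
    rw [Nat.count_succ, hcount]
    split_ifs <;> grind

theorem card_filter_fin_eq_count (p : ℕ → Prop) [DecidablePred p] (k : ℕ) :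
    (Finset.univ.filter fun i : Fin k => p i).card = Nat.count p k := by
  rw [Nat.count_eq_card_filter_range, Finset.card_filter, Finset.card_filter,
    Fin.sum_univ_eq_sum_range (fun i => if p i then 1 else 0)]

theorem count_mvals {k : ℕ} (f : Fin k → ℕ) (n : ℕ) :
    (mvals f).count n = (Finset.univ.filter fun i => f i = n).card := by
  simp only [mvals, Multiset.count_map, Finset.card_def, Finset.filter_val, eq_comm]

/-- Type B: if λ is a weakly increasing sequence of 2m+1 naturals in which every
even number occurs an even number of times, then λ̄ i = λ i + i is strictly
increasing and exactly m of its values are even. -/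
theorem typeB_staircase_even_count (m : ℕ) (lam : Fin (2 * m + 1) → ℕ)
    (hmono : Monotone lam)
    (hadm : ∀ n : ℕ, Even n → Even ((mvals lam).count n)) :
    StrictMono (fun i : Fin (2 * m + 1) => lam i + (i : ℕ)) ∧
      (Finset.univ.filter fun i : Fin (2 * m + 1) => Even (lam i + (i : ℕ))).card = m := by
  refine ⟨fun i j hij => add_lt_add_of_le_of_lt (hmono hij.le) hij, ?_⟩
  let f : ℕ → ℕ := fun i => if h : i < 2 * m + 1 then lam ⟨i, h⟩ else 0
  have hf : ∀ i : Fin (2 * m + 1), f i = lam i := fun i => dif_pos i.isLt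
  have hcount := count_even_add_self_eq_half f (2 * m + 1)
    (fun i j hij hj => by
      simp only [f, dif_pos hj, dif_pos (hij.trans_lt hj)]
      exact hmono hij)
    (fun n hn => by
      have h := hadm n hn
      rw [count_mvals] at h
      rw [← card_filter_fin_eq_count]
      simpa only [hf] using h)
  rw [← card_filter_fin_eq_count] at hcount
  simp only [hf] at hcount
  omega
end

section
/- Let m be a natural number and let λ : Fin (2m) → ℕ be monotone such that every odd natural number occurs an even number of times among the values of λ (counted with multiplicity). Then the map λ̄ : Fin (2m) → ℕ defined by λ̄ i = λ i + i is strictly increasing and exactly m of its values are even (hence exactly m of its values are odd). (This is the paper's claim, in the type C construction of u-symbols, that the list of even parts of λ̄ has exactly m entries.) -/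
/-- The alternating sum over an even number of consecutive natural numbers vanishes. -/
theorem sum_neg_one_pow_eq_zero_of_ordConnected (S : Finset ℕ)
    (hS : (S : Set ℕ).OrdConnected) (hcard : Even S.card) :
    ∑ i ∈ S, (-1 : ℤ) ^ i = 0 := by
  obtain rfl | hne := S.eq_empty_or_nonempty
  · simp
  have hIco : S = Finset.Ico (S.min' hne) (S.max' hne + 1) := by
    ext x
    rw [Finset.mem_Ico, Nat.lt_succ_iff]
    refine ⟨fun hx => ⟨S.min'_le x hx, S.le_max' x hx⟩, fun hx => ?_⟩
    exact hS.out (S.min'_mem hne) (S.max'_mem hne) hx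
  rw [hIco, Nat.card_Ico] at hcard
  rw [hIco, Finset.sum_Ico_eq_sum_range]
  simp_rw [pow_add]
  rw [← Finset.mul_sum, neg_one_geom_sum, if_pos hcard, mul_zero]

theorem sum_fiber_neg_one_pow_eq_zero {k : ℕ} {f : Fin k → ℕ} (hf : Monotone f) (n : ℕ)
    (hn : Even ((mvals f).count n)) :
    ∑ i with f i = n, (-1 : ℤ) ^ (i : ℕ) = 0 := by
  rw [count_mvals, ← Finset.card_map Fin.valEmbedding] at hn
  have h := sum_neg_one_pow_eq_zero_of_ordConnected _ ⟨?_⟩ hn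
  · simpa using h
  · intro x hx y hy z hz
    simp only [Finset.coe_map, Fin.valEmbedding_apply, Set.mem_image, SetLike.mem_coe,
      Finset.mem_filter, Finset.mem_univ, true_and] at hx hy ⊢
    obtain ⟨a, ha, rfl⟩ := hx
    obtain ⟨b, hb, rfl⟩ := hy
    refine ⟨⟨z, hz.2.trans_lt b.isLt⟩, le_antisymm ?_ ?_, rfl⟩
    · exact hb ▸ hf (Fin.le_def.2 hz.2)
    · exact ha ▸ hf (Fin.le_def.2 hz.1)

theorem sum_odd_neg_one_pow_eq_zero {k : ℕ} {f : Fin k → ℕ} (hf : Monotone f)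
    (hadm : ∀ n : ℕ, Odd n → Even ((mvals f).count n)) :
    ∑ i with Odd (f i), (-1 : ℤ) ^ (i : ℕ) = 0 := by
  rw [← Finset.sum_fiberwise_of_maps_to (g := f)
    (t := (Finset.univ.image f).filter Odd) (by simp)]
  refine Finset.sum_eq_zero fun n hn => ?_
  have hodd := (Finset.mem_filter.1 hn).2
  rw [← sum_fiber_neg_one_pow_eq_zero hf n (hadm n hodd), Finset.filter_filter]
  refine Finset.sum_congr (Finset.filter_congr fun i _ => ?_) fun _ _ => rfl
  exact ⟨And.right, fun h => ⟨h ▸ hodd, h⟩⟩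

/-- Type C: if λ is a weakly increasing sequence of 2m naturals in which every
odd number occurs an even number of times, then λ̄ i = λ i + i is strictly
increasing and exactly m of its values are even. -/
theorem typeC_staircase_even_count (m : ℕ) (lam : Fin (2 * m) → ℕ)
    (hmono : Monotone lam)
    (hadm : ∀ n : ℕ, Odd n → Even ((mvals lam).count n)) :
    StrictMono (fun i : Fin (2 * m) => lam i + (i : ℕ)) ∧
      (Finset.univ.filter fun i : Fin (2 * m) => Even (lam i + (i : ℕ))).card = m := by
  refine ⟨fun i j hij => add_lt_add_of_le_of_lt (hmono hij.le) hij, ?_⟩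
  have hsum : ∑ i : Fin (2 * m), (-1 : ℤ) ^ (lam i + (i : ℕ)) = 0 := by
    have hsplit : ∀ i : Fin (2 * m), (-1 : ℤ) ^ (lam i + (i : ℕ)) =
        (-1) ^ (i : ℕ) - 2 * if Odd (lam i) then (-1) ^ (i : ℕ) else 0 := by
      intro i
      rw [pow_add]
      split_ifs with h
      · rw [h.neg_one_pow]; ring
      · rw [(Nat.not_odd_iff_even.1 h).neg_one_pow]; ring
    rw [Finset.sum_congr rfl fun i _ => hsplit i, Finset.sum_sub_distrib, ← Finset.mul_sum,
      ← Finset.sum_filter, sum_odd_neg_one_pow_eq_zero hmono hadm,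
      Fin.sum_univ_eq_sum_range (fun i => (-1 : ℤ) ^ i), neg_one_geom_sum]
    simp
  have hcount : ∀ i : Fin (2 * m), (-1 : ℤ) ^ (lam i + (i : ℕ)) =
      2 * (if Even (lam i + (i : ℕ)) then 1 else 0) - 1 := by
    intro i
    split_ifs with h
    · rw [h.neg_one_pow]; norm_num
    · rw [(Nat.not_even_iff_odd.1 h).neg_one_pow]; norm_num
  rw [Finset.sum_congr rfl fun i _ => hcount i, Finset.sum_sub_distrib, ← Finset.mul_sum,
    Finset.sum_boole] at hsum
  simp only [Finset.sum_const, Finset.card_univ, Fintype.card_fin, nsmul_eq_mul, mul_one] at hsum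
  push_cast at hsum
  omega
end

section
/- Let m be a natural number and let λ, λ' : Fin (2m+1) → ℕ be monotone, B-admissible, and with equal total sums. Let (ξ̄, η̄) and (ξ̄', η̄') be their u-symbols and U(λ), U(λ') the associated u-symbol multisets. If σ_i(U(λ)) ≤ σ_i(U(λ')) for every i, then σ_i(λ) ≤ σ_i(λ') for every i; moreover, if in addition (ξ̄, η̄) ≠ (ξ̄', η̄'), then σ_i(λ) < σ_i(λ') for some i. (This is Lemme 3.5 of the paper in type B: if ξ̄ ∪ η̄ ≤ ξ̄' ∪ η̄' in the dominance order then λ ≤ λ', with equality if and only if the u-symbols coincide.) -/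
/-- The first row ξ̄ of a u-symbol: ξ̄ i = ξ i + i where ξ i = (ξ* i − 1)/2. -/
def xiBar {l : ℕ} (xis : Fin l → ℕ) : Fin l → ℕ :=
  fun i => (xis i - 1) / 2 + (i : ℕ)

/-- The second row η̄ of a u-symbol: η̄ i = η i + i where η i = η* i / 2. -/
def etaBar {l : ℕ} (etas : Fin l → ℕ) : Fin l → ℕ :=
  fun i => etas i / 2 + (i : ℕ)

theorem mvals_eq_map_range {n : ℕ} (g : ℕ → ℕ) :
    mvals (fun i : Fin n => g i) = (Multiset.range n).map g := by
  unfold mvals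
  have h := congrArg Finset.val (Fin.map_valEmbedding_univ (n := n))
  rw [Finset.map_val, Nat.Iio_eq_range] at h
  rw [← Finset.range_val, ← h, Multiset.map_map]
  rfl

theorem mem_mvals {k : ℕ} {f : Fin k → ℕ} {x : ℕ} : x ∈ mvals f ↔ x ∈ Set.range f := by
  simp [mvals]

/-- The `i` largest values of a weakly increasing sequence of length `n` are its last `i` terms. -/
theorem sigmaTop_map_range {n : ℕ} {g : ℕ → ℕ}
    (hg : ∀ a b, a ≤ b → b < n → g a ≤ g b) (i : ℕ) :
    sigmaTop ((Multiset.range n).map g) i = ∑ k ∈ Finset.Ico (n - i) n, g k := by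
  have hsort : ((Multiset.range n).map g).sort (· ≤ ·) = (List.range n).map g := by
    have : (Multiset.range n).map g = ((List.range n).map g : List ℕ) := rfl
    rw [this, Multiset.coe_sort]
    apply List.mergeSort_of_pairwise
    rw [List.pairwise_map]
    refine List.pairwise_lt_range.imp_of_mem ?_
    intro a b _ hb hab
    simpa using hg a b hab.le (List.mem_range.1 hb)
  unfold sigmaTop
  rw [hsort, List.take_reverse, List.sum_reverse, List.length_map, List.length_range,
    ← List.map_drop, List.range_eq_range', List.drop_range', Nat.mul_one, Nat.zero_add]
  rfl

/-- `v / 2` plus the number of elements of `M` below `v` with the same parity as `v`. -/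
def symbolEntry (M : Multiset ℕ) (v : ℕ) : ℕ :=
  v / 2 + M.countP (fun w => w < v ∧ w % 2 = v % 2)

theorem countP_mvals_of_strictMono {k : ℕ} {f : Fin k → ℕ} (hf : StrictMono f) (r : ℕ)
    (hr : ∀ i, f i % 2 = r) (j : Fin k) :
    (mvals f).countP (fun w => w < f j ∧ w % 2 = r) = j := by
  unfold mvals
  rw [Multiset.countP_map]
  have : (Finset.univ.filter fun i => f i < f j ∧ f i % 2 = r) = Finset.Iio j := by
    ext i
    simp [hf.lt_iff_lt, hr]
  have h2 := congrArg Finset.card this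
  rw [Fin.card_Iio] at h2
  exact h2

theorem countP_mvals_eq_zero {k : ℕ} {f : Fin k → ℕ} (v r : ℕ) (hr : ∀ i, f i % 2 ≠ r) :
    (mvals f).countP (fun w => w < v ∧ w % 2 = r) = 0 := by
  rw [Multiset.countP_eq_zero]
  intro a ha
  obtain ⟨i, rfl⟩ := mem_mvals.1 ha
  exact fun h => hr i h.2

theorem mvals_xiBar_add_mvals_etaBar {k l : ℕ} {etas : Fin k → ℕ} {xis : Fin l → ℕ}
    (hetas : StrictMono etas) (hxis : StrictMono xis)
    (hetaseven : ∀ i, Even (etas i)) (hxisodd : ∀ i, Odd (xis i)) :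
    mvals (xiBar xis) + mvals (etaBar etas) =
      (mvals etas + mvals xis).map (symbolEntry (mvals etas + mvals xis)) := by
  have he : ∀ i, etas i % 2 = 0 := fun i => Nat.even_iff.1 (hetaseven i)
  have ho : ∀ i, xis i % 2 = 1 := fun i => Nat.odd_iff.1 (hxisodd i)
  rw [Multiset.map_add, add_comm]
  congr 1
  · unfold mvals
    rw [Multiset.map_map]
    refine Multiset.map_congr rfl fun j _ => ?_
    change _ = symbolEntry (mvals etas + mvals xis) (etas j)
    rw [symbolEntry, Multiset.countP_add, he j, countP_mvals_of_strictMono hetas 0 he,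
      countP_mvals_eq_zero _ _ (by simp [ho])]
    rfl
  · unfold mvals
    rw [Multiset.map_map]
    refine Multiset.map_congr rfl fun j _ => ?_
    change _ = symbolEntry (mvals etas + mvals xis) (xis j)
    rw [symbolEntry, Multiset.countP_add, ho j, countP_mvals_of_strictMono hxis 1 ho,
      countP_mvals_eq_zero _ _ (by simp [he])]
    have := ho j
    unfold xiBar
    omega

/-- For a strictly increasing sequence, only earlier indices contribute to a symbol entry. -/
theorem symbolEntry_map_range {n : ℕ} {g : ℕ → ℕ}
    (hg : ∀ a b, a < b → b < n → g a < g b) {s : ℕ} (hs : s < n) :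
    symbolEntry ((Multiset.range n).map g) (g s) =
      g s / 2 + Nat.count (fun q => g q % 2 = g s % 2) s := by
  rw [symbolEntry, Multiset.countP_map, Nat.count_eq_card_filter_range]
  congr 1
  have : ((Finset.range n).filter fun q => g q < g s ∧ g q % 2 = g s % 2) =
      (Finset.range s).filter fun q => g q % 2 = g s % 2 := by
    ext q
    simp only [Finset.mem_filter, Finset.mem_range]
    constructor
    · rintro ⟨hq, h1, h2⟩
      refine ⟨?_, h2⟩
      by_contra! h
      rcases h.eq_or_lt with rfl | h
      · exact lt_irrefl _ h1
      · exact lt_asymm h1 (hg _ _ h hq)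
    · rintro ⟨hq, h2⟩
      exact ⟨hq.trans hs, hg _ _ hq hs, h2⟩
  exact congrArg Finset.card this

/-- If every even number has even multiplicity, so does the set of indices of even values
below a bound. -/
theorem even_card_even_lt {n : ℕ} {g : ℕ → ℕ}
    (hadm : ∀ b, Even b → Even (((Multiset.range n).map g).count b)) (B : ℕ) :
    Even ((Finset.range n).filter fun q => Even (g q) ∧ g q < B).card := by
  rw [Finset.card_eq_sum_card_fiberwise (f := g) (t := (Finset.range B).filter Even)
    (by intro q hq; simp at hq ⊢; exact ⟨hq.2.2, hq.2.1⟩)]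
  refine Finset.even_sum _ fun b hb => ?_
  rw [Finset.mem_filter, Finset.mem_range] at hb
  have h := hadm b hb.2
  rw [Multiset.count_map] at h
  have : ((Finset.range n).filter fun q => Even (g q) ∧ g q < B).filter (fun q => g q = b) =
      (Finset.range n).filter fun q => b = g q := by
    ext q
    simp only [Finset.mem_filter]
    constructor
    · rintro ⟨hq, hqb⟩; exact ⟨hq.1, hqb.symm⟩
    · rintro ⟨hq, rfl⟩; exact ⟨⟨hq, hb.2, hb.1⟩, rfl⟩
  rw [this]
  exact h

theorem even_count_even {n : ℕ} {g : ℕ → ℕ}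
    (hadm : ∀ b, Even b → Even (((Multiset.range n).map g).count b)) :
    Even (Nat.count (fun q => Even (g q)) n) := by
  have h := even_card_even_lt hadm ((∑ q ∈ Finset.range n, g q) + 1)
  rw [Nat.count_eq_card_filter_range]
  convert h using 2
  refine Finset.filter_congr fun q hq => ?_
  have := Finset.single_le_sum (f := g) (fun _ _ => Nat.zero_le _) hq
  simp only [iff_self_and]
  omega

/-- An odd number of even values among the first `s` means that `s` splits a block of equal
even values. -/
theorem eq_of_odd_count_even {n : ℕ} {g : ℕ → ℕ}
    (hmono : ∀ a b, a ≤ b → b < n → g a ≤ g b)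
    (hadm : ∀ b, Even b → Even (((Multiset.range n).map g).count b)) {s : ℕ} (hs : s < n)
    (hodd : Odd (Nat.count (fun q => Even (g q)) s)) :
    Even (g s) ∧ 0 < s ∧ g (s - 1) = g s := by
  by_cases hex : ∃ q < s, g q = g s ∧ Even (g s)
  · obtain ⟨q, hq, h1, h2⟩ := hex
    refine ⟨h2, by omega, le_antisymm (hmono _ _ (by omega) hs) ?_⟩
    rw [← h1]
    exact hmono _ _ (by omega) (by omega)
  · exfalso
    have h := even_card_even_lt hadm (g s)
    rw [Nat.count_eq_card_filter_range, ← Nat.not_even_iff_odd] at hodd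
    apply hodd
    convert h using 2
    ext q
    simp only [Finset.mem_filter, Finset.mem_range]
    constructor
    · rintro ⟨hq, he⟩
      refine ⟨hq.trans hs, he, lt_of_le_of_ne (hmono _ _ hq.le hs) fun h => ?_⟩
      exact hex ⟨q, hq, h, h ▸ he⟩
    · rintro ⟨hq, he, hlt⟩
      refine ⟨?_, he⟩
      by_contra! h
      exact absurd (hmono _ _ h hq) (by omega)

theorem count_odd_add_index {n : ℕ} {g : ℕ → ℕ}
    (hmono : ∀ a b, a ≤ b → b < n → g a ≤ g b)
    (hadm : ∀ b, Even b → Even (((Multiset.range n).map g).count b)) {s : ℕ} (hs : s ≤ n) :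
    Nat.count (fun q => (g q + q) % 2 = 1) s =
      if Even (Nat.count (fun q => Even (g q)) s) then (s + 1) / 2
      else if Even s then s / 2 + 1 else s / 2 := by
  induction s with
  | zero => simp
  | succ s ih =>
    have ih := ih (by omega)
    have h := eq_of_odd_count_even hmono hadm (s := s) (by omega)
    rw [Nat.count_succ, Nat.count_succ, ih]
    simp only [Nat.even_iff, Nat.odd_iff] at h ⊢
    split_ifs <;> omega

theorem count_parity_compl (g : ℕ → ℕ) (s : ℕ) :
    Nat.count (fun q => g q % 2 = 0) s + Nat.count (fun q => g q % 2 = 1) s = s := by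
  induction s with
  | zero => simp
  | succ s ih =>
    rw [Nat.count_succ, Nat.count_succ]
    split_ifs <;> omega

/-- The sorted entries `z` of the u-symbol of a B-admissible sequence `g`, with `c s = 1` exactly
when the cut at `s` separates a pair of equal even parts. -/
theorem exists_sorted_symbol {n : ℕ} {g : ℕ → ℕ} {k l : ℕ}
    {etas : Fin k → ℕ} {xis : Fin l → ℕ}
    (hmono : ∀ a b, a ≤ b → b < n → g a ≤ g b)
    (hadm : ∀ b, Even b → Even (((Multiset.range n).map g).count b))
    (hetas : StrictMono etas) (hxis : StrictMono xis)
    (hetaseven : ∀ i, Even (etas i)) (hxisodd : ∀ i, Odd (xis i))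
    (henum : (Multiset.range n).map (fun i => g i + i) = mvals etas + mvals xis) :
    ∃ z c : ℕ → ℕ,
      mvals (xiBar xis) + mvals (etaBar etas) = (Multiset.range n).map z ∧
      (∀ s, c s ≤ 1) ∧ c 0 = 0 ∧ c n = 0 ∧
      (∀ s < n, 2 * z s + 1 + c s = g s + 2 * s + c (s + 1)) ∧
      ∀ s, s + 1 < n → c (s + 1) = 1 → z s = z (s + 1) := by
  have hrel : ∀ s < n, 2 * symbolEntry ((Multiset.range n).map fun i => g i + i) (g s + s) + 1 +
      Nat.count (fun q => Even (g q)) s % 2 =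
      g s + 2 * s + Nat.count (fun q => Even (g q)) (s + 1) % 2 := by
    intro s hs
    have hlt : ∀ a b, a < b → b < n → g a + a < g b + b := fun a b hab hb => by
      have := hmono a b hab.le hb
      omega
    rw [symbolEntry_map_range (g := fun i => g i + i) hlt hs]
    have h1 := count_odd_add_index hmono hadm hs.le
    have h2 := count_parity_compl (fun i => g i + i) s
    have h3 := eq_of_odd_count_even hmono hadm hs
    rw [Nat.count_succ]
    simp only [Nat.even_iff, Nat.odd_iff] at h1 h2 h3 ⊢
    rcases Nat.mod_two_eq_zero_or_one (g s + s) with h | h <;> simp only [h] <;>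
      split_ifs at h1 ⊢ <;> omega
  refine ⟨fun i => symbolEntry ((Multiset.range n).map fun i => g i + i) (g i + i),
    fun s => Nat.count (fun q => Even (g q)) s % 2, ?_, fun s => Nat.le_of_lt_succ (Nat.mod_lt _ two_pos), by simp,
    Nat.even_iff.1 (even_count_even hadm), hrel, ?_⟩
  · rw [mvals_xiBar_add_mvals_etaBar hetas hxis hetaseven hxisodd, ← henum, Multiset.map_map]
    rfl
  · intro s hs hc
    have h0 := hrel s (by omega)
    have h1 := hrel (s + 1) hs
    obtain ⟨he, -, heq⟩ := eq_of_odd_count_even hmono hadm hs (Nat.odd_iff.2 hc)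
    rw [Nat.add_sub_cancel] at heq
    have e1 := Nat.count_succ (fun q => Even (g q)) s
    have e2 := Nat.count_succ (fun q => Even (g q)) (s + 1)
    rw [if_pos (heq ▸ he)] at e1
    rw [if_pos he] at e2
    dsimp only at hc ⊢
    omega

theorem eq_of_mvals_add_eq {k l : ℕ} {etas etas' : Fin k → ℕ} {xis xis' : Fin l → ℕ}
    (hetas : StrictMono etas) (hxis : StrictMono xis)
    (hetas' : StrictMono etas') (hxis' : StrictMono xis')
    (hetaseven : ∀ i, Even (etas i)) (hxisodd : ∀ i, Odd (xis i))
    (hetaseven' : ∀ i, Even (etas' i)) (hxisodd' : ∀ i, Odd (xis' i))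
    (h : mvals etas + mvals xis = mvals etas' + mvals xis') : etas = etas' ∧ xis = xis' := by
  have hmem : ∀ x, (x ∈ Set.range etas ∨ x ∈ Set.range xis) ↔
      (x ∈ Set.range etas' ∨ x ∈ Set.range xis') := fun x => by
    rw [← mem_mvals, ← mem_mvals, ← mem_mvals, ← mem_mvals, ← Multiset.mem_add,
      ← Multiset.mem_add, h]
  have he : ∀ x ∈ Set.range etas, Even x := by rintro _ ⟨i, rfl⟩; exact hetaseven i
  have he' : ∀ x ∈ Set.range etas', Even x := by rintro _ ⟨i, rfl⟩; exact hetaseven' i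
  have ho : ∀ x ∈ Set.range xis, ¬ Even x := by
    rintro _ ⟨i, rfl⟩; exact Nat.not_even_iff_odd.2 (hxisodd i)
  have ho' : ∀ x ∈ Set.range xis', ¬ Even x := by
    rintro _ ⟨i, rfl⟩; exact Nat.not_even_iff_odd.2 (hxisodd' i)
  constructor
  · refine (hetas.range_inj hetas').1 (Set.ext fun x => ?_)
    have := hmem x; have := he x; have := he' x; have := ho x; have := ho' x
    tauto
  · refine (hxis.range_inj hxis').1 (Set.ext fun x => ?_)
    have := hmem x; have := he x; have := he' x; have := ho x; have := ho' x
    tauto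

theorem exists_extension {n : ℕ} (f : Fin n → ℕ) : ∃ g : ℕ → ℕ, f = fun i : Fin n => g i :=
  ⟨fun i => if h : i < n then f ⟨i, h⟩ else 0, by ext i; simp⟩

/-- The tail sums of `2 z + 1` and of `g` differ by a fixed amount and the correction `c`. -/
theorem tail_sum_relation {n : ℕ} {g z c : ℕ → ℕ} (hcn : c n = 0)
    (hrel : ∀ s < n, 2 * z s + 1 + c s = g s + 2 * s + c (s + 1)) {s : ℕ} (hs : s ≤ n) :
    2 * ∑ k ∈ Finset.Ico s n, z k + (n - s) + c s =
      ∑ k ∈ Finset.Ico s n, g k + 2 * ∑ k ∈ Finset.Ico s n, k := by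
  induction hs using Nat.decreasingInduction with
  | self => simp [hcn]
  | of_succ s hs ih =>
    rw [Finset.sum_eq_sum_Ico_succ_bot hs, Finset.sum_eq_sum_Ico_succ_bot hs,
      Finset.sum_eq_sum_Ico_succ_bot hs]
    have := hrel s hs
    omega

theorem sorted_symbol_mono {n : ℕ} {g z c : ℕ → ℕ}
    (hmono : ∀ a b, a ≤ b → b < n → g a ≤ g b) (hc : ∀ s, c s ≤ 1)
    (hrel : ∀ s < n, 2 * z s + 1 + c s = g s + 2 * s + c (s + 1)) :
    ∀ a b, a ≤ b → b < n → z a ≤ z b := by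
  intro a b hab
  induction b, hab using Nat.le_induction with
  | base => exact fun _ => le_rfl
  | succ b _ ih =>
    intro hb
    have := ih (by omega)
    have := hmono b (b + 1) (by omega) hb
    have := hrel b (by omega)
    have := hrel (b + 1) hb
    have := hc (b + 1)
    omega

/-- Lemme 3.5 in type B.  Let λ, λ' be monotone B-admissible sequences of
length 2m+1 with equal sums, with λ̄ enumerated by the odd values ξ* and the
even values η*, and similarly for λ'.  If the u-symbol multiset of λ is
dominated by that of λ', then λ is dominated by λ', and strictly so in some
degree unless the two u-symbols coincide. -/
theorem lemme_ordre_typeB (m : ℕ) (lam lam' : Fin (2 * m + 1) → ℕ)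
    (hmono : Monotone lam) (hmono' : Monotone lam')
    (hadm : ∀ n : ℕ, Even n → Even ((mvals lam).count n))
    (hadm' : ∀ n : ℕ, Even n → Even ((mvals lam').count n))
    (hsum : (mvals lam).sum = (mvals lam').sum)
    (etas : Fin m → ℕ) (xis : Fin (m + 1) → ℕ)
    (etas' : Fin m → ℕ) (xis' : Fin (m + 1) → ℕ)
    (hetas : StrictMono etas) (hxis : StrictMono xis)
    (hetas' : StrictMono etas') (hxis' : StrictMono xis')
    (hetaseven : ∀ i, Even (etas i)) (hxisodd : ∀ i, Odd (xis i))
    (hetaseven' : ∀ i, Even (etas' i)) (hxisodd' : ∀ i, Odd (xis' i))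
    (henum : mvals (fun i : Fin (2 * m + 1) => lam i + (i : ℕ)) = mvals etas + mvals xis)
    (henum' : mvals (fun i : Fin (2 * m + 1) => lam' i + (i : ℕ)) = mvals etas' + mvals xis')
    (hdom : ∀ i, sigmaTop (mvals (xiBar xis) + mvals (etaBar etas)) i ≤
      sigmaTop (mvals (xiBar xis') + mvals (etaBar etas')) i) :
    (∀ i, sigmaTop (mvals lam) i ≤ sigmaTop (mvals lam') i) ∧
      ((xiBar xis, etaBar etas) ≠ (xiBar xis', etaBar etas') →
        ∃ i, sigmaTop (mvals lam) i < sigmaTop (mvals lam') i) := by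
  obtain ⟨g, rfl⟩ := exists_extension lam
  obtain ⟨g', rfl⟩ := exists_extension lam'
  generalize hn : 2 * m + 1 = n at *
  rw [mvals_eq_map_range] at hadm hadm'
  have hg : ∀ a b, a ≤ b → b < n → g a ≤ g b := fun a b hab hb =>
    hmono (a := ⟨a, by omega⟩) (b := ⟨b, hb⟩) hab
  have hg' : ∀ a b, a ≤ b → b < n → g' a ≤ g' b := fun a b hab hb =>
    hmono' (a := ⟨a, by omega⟩) (b := ⟨b, hb⟩) hab
  rw [mvals_eq_map_range (fun i => g i + i)] at henum
  rw [mvals_eq_map_range (fun i => g' i + i)] at henum'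
  obtain ⟨z, c, hU, hc, hc0, hcn, hrel, hz⟩ :=
    exists_sorted_symbol hg hadm hetas hxis hetaseven hxisodd henum
  obtain ⟨z', c', hU', hc', -, hcn', hrel', -⟩ :=
    exists_sorted_symbol hg' hadm' hetas' hxis' hetaseven' hxisodd' henum'
  have htail : ∀ s ≤ n, ∑ k ∈ Finset.Ico s n, z k ≤ ∑ k ∈ Finset.Ico s n, z' k := by
    intro s hs
    have h := hdom (n - s)
    rwa [hU, hU', sigmaTop_map_range (sorted_symbol_mono hg hc hrel),
      sigmaTop_map_range (sorted_symbol_mono hg' hc' hrel'), Nat.sub_sub_self hs] at h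
  have hle : ∀ s ≤ n, ∑ k ∈ Finset.Ico s n, g k ≤ ∑ k ∈ Finset.Ico s n, g' k := by
    intro s hs
    have t := tail_sum_relation hcn hrel hs
    have t' := tail_sum_relation hcn' hrel' hs
    have d := htail s hs
    have := hc s
    by_contra! hlt
    have hcs : c s = 1 := by omega
    have hcs' : c' s = 0 := by omega
    have heq : ∑ k ∈ Finset.Ico s n, z k = ∑ k ∈ Finset.Ico s n, z' k := by omega
    obtain ⟨p, rfl⟩ : ∃ p, s = p + 1 := Nat.exists_eq_succ_of_ne_zero (by rintro rfl; omega)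
    have hsn : p + 1 < n := lt_of_le_of_ne hs (by intro h; rw [h] at hcs; omega)
    have hzz := hz p hsn hcs
    have d0 := htail p (by omega)
    have d2 := htail (p + 1 + 1) hsn
    have split : ∀ (f : ℕ → ℕ) (q : ℕ), q < n →
        ∑ k ∈ Finset.Ico q n, f k = f q + ∑ k ∈ Finset.Ico (q + 1) n, f k :=
      fun f q hq => Finset.sum_eq_sum_Ico_succ_bot hq f
    have := split z p (by omega)
    have := split z' p (by omega)
    have := split z (p + 1) hsn
    have := split z' (p + 1) hsn
    have := hrel' p (by omega)
    have := hrel' (p + 1) hsn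
    have := hg' p (p + 1) (by omega) hsn
    omega
  have hsig : ∀ i, sigmaTop (mvals fun i : Fin n => g i) i = ∑ k ∈ Finset.Ico (n - i) n, g k :=
    fun i => by rw [mvals_eq_map_range, sigmaTop_map_range hg]
  have hsig' : ∀ i, sigmaTop (mvals fun i : Fin n => g' i) i = ∑ k ∈ Finset.Ico (n - i) n, g' k :=
    fun i => by rw [mvals_eq_map_range, sigmaTop_map_range hg']
  refine ⟨fun i => ?_, fun hne => ?_⟩
  · rw [hsig, hsig']
    exact hle _ (Nat.sub_le _ _)
  · by_contra! hge
    have hEq : ∀ s ≤ n, ∑ k ∈ Finset.Ico s n, g k = ∑ k ∈ Finset.Ico s n, g' k := by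
      intro s hs
      have h := hge (n - s)
      rw [hsig, hsig', Nat.sub_sub_self hs] at h
      exact le_antisymm (hle s hs) h
    have hgg : ∀ s < n, g s = g' s := by
      intro s hs
      have h0 := hEq s hs.le
      have h1 := hEq (s + 1) hs
      rw [Finset.sum_eq_sum_Ico_succ_bot hs, Finset.sum_eq_sum_Ico_succ_bot hs] at h0
      omega
    have hM : mvals etas + mvals xis = mvals etas' + mvals xis' := by
      rw [← henum, ← henum']
      exact Multiset.map_congr rfl fun s hs => by rw [hgg s (Multiset.mem_range.1 hs)]
    obtain ⟨rfl, rfl⟩ := eq_of_mvals_add_eq hetas hxis hetas' hxis' hetaseven hxisodd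
      hetaseven' hxisodd' hM
    exact hne rfl
end

section
/- Let m ≥ 1 be a natural number and let λ, λ' : Fin (2m) → ℕ be monotone, D-admissible, and with equal total sums. Let (ξ̄, η̄) and (ξ̄', η̄') be their u-symbols and U(λ), U(λ') the associated u-symbol multisets. If σ_i(U(λ)) ≤ σ_i(U(λ')) for every i, then σ_i(λ) ≤ σ_i(λ') for every i; moreover, if in addition (ξ̄, η̄) ≠ (ξ̄', η̄'), then σ_i(λ) < σ_i(λ') for some i. (This is Lemme 3.5 of the paper in type D.) -/
open Finset

/-- A monotone listing of `N` natural numbers computes `sigmaTop` as a difference of prefix sums. -/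
lemma sigmaTop_add_sum_range {N : ℕ} {l : ℕ → ℕ}
    (hl : ∀ i j, i ≤ j → j < N → l i ≤ l j) (k : ℕ) :
    sigmaTop (mvals fun i : Fin N => l i) k + ∑ i ∈ range (N - k), l i =
      ∑ i ∈ range N, l i := by
  have hcoe : mvals (fun i : Fin N => l i) = (((List.range N).map l : List ℕ) : Multiset ℕ) := by
    have h : (List.range N).map l = List.ofFn (fun i : Fin N => l i) := by
      apply List.ext_getElem <;> simp
    rw [h, mvals, List.ofFn_eq_map, ← Multiset.map_coe]
    rfl
  have hsorted : ((List.range N).map l).Pairwise (· ≤ ·) := by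
    rw [List.pairwise_map]
    refine List.Pairwise.imp_of_mem ?_ List.pairwise_lt_range
    intro a b _ hb hab
    exact hl a b hab.le (List.mem_range.1 hb)
  have hsort : (mvals fun i : Fin N => l i).sort (· ≤ ·) = (List.range N).map l := by
    rw [hcoe, Multiset.coe_sort]
    exact List.mergeSort_of_pairwise (by simpa using hsorted)
  have hprefix (n : ℕ) : ∑ i ∈ range n, l i = ((List.range n).map l).sum := rfl
  have htake : (List.range (N - k)).map l = ((List.range N).map l).take (N - k) := by
    rw [← List.map_take, List.take_range, min_eq_left (Nat.sub_le N k)]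
  rw [sigmaTop, hsort, List.take_reverse, List.sum_reverse, hprefix, hprefix, htake]
  simp only [List.length_map, List.length_range]
  rw [add_comm, List.sum_take_add_sum_drop]

/-- The number of `j < n` such that `l j + j` has residue `p` modulo 2. -/
def parityCount (l : ℕ → ℕ) (p n : ℕ) : ℕ :=
  #{j ∈ range n | (l j + j) % 2 = p}

/-- The entry of the u-symbol coming from the `i`-th part of `l`. -/
def uEntry (l : ℕ → ℕ) (i : ℕ) : ℕ :=
  (l i + i) / 2 + parityCount l ((l i + i) % 2) i

/-- The number of odd entries minus the number of even entries among the `l j + j`, `j < n`. -/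
def parityDefect (l : ℕ → ℕ) (n : ℕ) : ℤ :=
  parityCount l 1 n - parityCount l 0 n

lemma parityCount_succ (l : ℕ → ℕ) (p n : ℕ) :
    parityCount l p (n + 1) = parityCount l p n + if (l n + n) % 2 = p then 1 else 0 := by
  unfold parityCount
  rw [range_add_one, filter_insert]
  split_ifs <;> simp

lemma parityCount_add (l : ℕ → ℕ) (n : ℕ) : parityCount l 0 n + parityCount l 1 n = n := by
  induction n with
  | zero => simp [parityCount]
  | succ n ih =>
    rw [parityCount_succ, parityCount_succ]
    rcases Nat.mod_two_eq_zero_or_one (l n + n) with h | h <;> simp [h] <;> omega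

lemma parityDefect_succ_of_even {l : ℕ → ℕ} {n : ℕ} (h : (l n + n) % 2 = 0) :
    parityDefect l (n + 1) = parityDefect l n - 1 := by
  simp [parityDefect, parityCount_succ, h]; ring

lemma parityDefect_succ_of_odd {l : ℕ → ℕ} {n : ℕ} (h : (l n + n) % 2 = 1) :
    parityDefect l (n + 1) = parityDefect l n + 1 := by
  simp [parityDefect, parityCount_succ, h]; ring

lemma sum_uEntry (l : ℕ → ℕ) (n : ℕ) :
    4 * ((∑ i ∈ range n, uEntry l i : ℕ) : ℤ) =
      2 * ((∑ i ∈ range n, l i : ℕ) : ℤ) + 2 * (n : ℤ) ^ 2 - 4 * n +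
        parityDefect l n * (parityDefect l n - 1) := by
  induction n with
  | zero => simp [parityDefect, parityCount]
  | succ n ih =>
    have hc : (parityCount l 0 n : ℤ) + parityCount l 1 n = n := by
      exact_mod_cast parityCount_add l n
    have hd : parityDefect l n = parityCount l 1 n - parityCount l 0 n := rfl
    rw [sum_range_succ, sum_range_succ, uEntry]
    rcases Nat.mod_two_eq_zero_or_one (l n + n) with h | h
    · have hq : (2 : ℤ) * ((l n + n) / 2 : ℕ) = l n + n := by omega
      rw [parityDefect_succ_of_even h, h]
      push_cast at hq ih ⊢
      linear_combination ih + 2 * hq + 2 * hc + 2 * hd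
    · have hq : (2 : ℤ) * ((l n + n) / 2 : ℕ) = l n + n - 1 := by omega
      rw [parityDefect_succ_of_odd h, h]
      push_cast at hq ih ⊢
      linear_combination ih + 2 * hq + 2 * hc - 2 * hd

/-- Every even number occurs an even number of times among the first `n` values of `l`. -/
def EvenCounts (l : ℕ → ℕ) (n : ℕ) : Prop :=
  ∀ v, Even v → Even #{j ∈ range n | l j = v}

/-- `n` does not cut a pair of equal even parts of `l`. -/
def IsCut (l : ℕ → ℕ) (n : ℕ) : Prop :=
  EvenCounts l n ∧ parityDefect l n = (n % 2 : ℕ)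

lemma card_filter_range_succ (l : ℕ → ℕ) (v n : ℕ) :
    #{j ∈ range (n + 1) | l j = v} = #{j ∈ range n | l j = v} + if l n = v then 1 else 0 := by
  rw [range_add_one, filter_insert]
  split_ifs <;> simp

lemma IsCut.succ_of_odd {l : ℕ → ℕ} {n : ℕ} (h : IsCut l n) (hn : l n % 2 = 1) :
    IsCut l (n + 1) := by
  refine ⟨fun v hv => ?_, ?_⟩
  · rw [card_filter_range_succ, if_neg]
    · simpa using h.1 v hv
    · rintro rfl
      rw [Nat.even_iff] at hv
      omega
  · have hd := h.2
    rcases Nat.mod_two_eq_zero_or_one n with hp | hp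
    · rw [parityDefect_succ_of_odd (by omega)]; omega
    · rw [parityDefect_succ_of_even (by omega)]; omega

lemma IsCut.add_two {l : ℕ → ℕ} {n : ℕ} (h : IsCut l n) (hn : l n % 2 = 0)
    (heq : l (n + 1) = l n) : IsCut l (n + 2) := by
  refine ⟨fun v hv => ?_, ?_⟩
  · rw [card_filter_range_succ, card_filter_range_succ, heq]
    have := h.1 v hv
    split_ifs
    · exact this.add (by decide : Even 2)
    · simpa using this
  · have hd := h.2
    rcases Nat.mod_two_eq_zero_or_one n with hp | hp
    · rw [parityDefect_succ_of_odd (by omega), parityDefect_succ_of_even (by omega)]; omega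
    · rw [parityDefect_succ_of_even (by omega), parityDefect_succ_of_odd (by omega)]; omega

/-- After a cut, an even part is followed by an equal part. -/
lemma IsCut.eq_succ {l : ℕ → ℕ} {N n : ℕ} (hl : ∀ i j, i ≤ j → j < N → l i ≤ l j)
    (hN : EvenCounts l N) (h : IsCut l n) (hnN : n < N) (hn : l n % 2 = 0) :
    n + 1 < N ∧ l (n + 1) = l n := by
  have hev : Even (l n) := Nat.even_iff.2 hn
  have hlt : #{j ∈ range (n + 1) | l j = l n} ≠ #{j ∈ range N | l j = l n} := by
    intro he
    have h₁ := hN _ hev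
    have h₂ := h.1 _ hev
    rw [← he, card_filter_range_succ, if_pos rfl] at h₁
    rw [Nat.even_iff] at h₁ h₂
    omega
  obtain ⟨j, hjN, hjv, hjn⟩ : ∃ j < N, l j = l n ∧ n < j := by
    by_contra! hcon
    apply hlt
    congr 1
    ext j
    simp only [mem_filter, mem_range]
    constructor
    · rintro ⟨h₁, h₂⟩; exact ⟨by omega, h₂⟩
    · rintro ⟨h₁, h₂⟩; exact ⟨Nat.lt_succ_of_le (hcon j h₁ h₂), h₂⟩
  have h₁ := hl n (n + 1) (by omega) (by omega)
  have h₂ := hl (n + 1) j hjn hjN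
  exact ⟨by omega, by omega⟩

/-- Each position is a cut, or it splits a pair of equal even parts between two cuts. -/
lemma isCut_or {l : ℕ → ℕ} {N : ℕ} (hl : ∀ i j, i ≤ j → j < N → l i ≤ l j)
    (hN : EvenCounts l N) (n : ℕ) (hn : n ≤ N) :
    IsCut l n ∨ ∃ k, n = k + 1 ∧ n < N ∧ IsCut l k ∧ IsCut l (k + 2) ∧
      l k % 2 = 0 ∧ l (k + 1) = l k := by
  induction n with
  | zero => exact Or.inl ⟨by simp [EvenCounts], by simp [parityDefect, parityCount]⟩
  | succ n ih =>
    rcases ih (by omega) with h | ⟨k, rfl, -, -, h, -⟩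
    · rcases Nat.mod_two_eq_zero_or_one (l n) with hp | hp
      · obtain ⟨h₁, h₂⟩ := h.eq_succ hl hN hn hp
        exact Or.inr ⟨n, rfl, h₁, h, h.add_two hp h₂, hp, h₂⟩
      · exact Or.inl (h.succ_of_odd hp)
    · exact Or.inl h

lemma IsCut.defect_eq_zero {l : ℕ → ℕ} {n : ℕ} (h : IsCut l n) :
    parityDefect l n * (parityDefect l n - 1) = 0 := by
  rw [h.2]
  rcases Nat.mod_two_eq_zero_or_one n with hp | hp <;> simp [hp]

lemma parityDefect_bounds {l : ℕ → ℕ} {N : ℕ} (hl : ∀ i j, i ≤ j → j < N → l i ≤ l j)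
    (hN : EvenCounts l N) {n : ℕ} (hn : n ≤ N) :
    -1 ≤ parityDefect l n ∧ parityDefect l n ≤ 2 := by
  rcases isCut_or hl hN n hn with h | ⟨k, rfl, -, h, -⟩
  · have := h.2; omega
  · have := h.2
    rcases Nat.mod_two_eq_zero_or_one (l k + k) with hp | hp
    · rw [parityDefect_succ_of_even hp]; omega
    · rw [parityDefect_succ_of_odd hp]; omega

lemma uEntry_le {l : ℕ → ℕ} {N : ℕ} (hl : ∀ i j, i ≤ j → j < N → l i ≤ l j)
    (hN : EvenCounts l N) (i j : ℕ) (hij : i ≤ j) (hj : j < N) : uEntry l i ≤ uEntry l j := by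
  induction j, hij using Nat.le_induction with
  | base => rfl
  | succ j hij ih =>
    refine (ih (by omega)).trans ?_
    have hb := parityDefect_bounds hl hN hj.le
    have hle := hl j (j + 1) (by omega) hj
    rw [uEntry, uEntry, parityCount_succ]
    rcases Nat.mod_two_eq_zero_or_one (l j + j) with hp | hp <;>
    rcases Nat.mod_two_eq_zero_or_one (l (j + 1) + (j + 1)) with hq | hq
    · simp only [hp, hq, if_true]; omega
    · rw [parityDefect_succ_of_even hp, parityDefect] at hb
      simp only [hp, hq]; omega
    · rw [parityDefect_succ_of_odd hp, parityDefect] at hb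
      simp only [hp, hq]; omega
    · simp only [hp, hq, if_true]; omega

lemma EvenCounts.isCut {l : ℕ → ℕ} {N : ℕ} (hl : ∀ i j, i ≤ j → j < N → l i ≤ l j)
    (hN : EvenCounts l N) : IsCut l N := by
  rcases isCut_or hl hN N le_rfl with h | ⟨k, -, h, -⟩
  · exact h
  · exact absurd h (lt_irrefl _)

/-- Comparison of the prefix sums of u-symbols implies that of the sequences. -/
lemma sum_range_le_of_uEntry {l l' : ℕ → ℕ} {N : ℕ}
    (hl : ∀ i j, i ≤ j → j < N → l i ≤ l j) (hl' : ∀ i j, i ≤ j → j < N → l' i ≤ l' j)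
    (hN : EvenCounts l N)
    (hU : ∀ n ≤ N, ∑ i ∈ range n, uEntry l' i ≤ ∑ i ∈ range n, uEntry l i)
    (n : ℕ) (hn : n ≤ N) : ∑ i ∈ range n, l' i ≤ ∑ i ∈ range n, l i := by
  have hnonneg (k : ℕ) : 0 ≤ parityDefect l' k * (parityDefect l' k - 1) := by
    rcases le_or_gt (parityDefect l' k) 0 with h | h <;> nlinarith
  have hcut {k : ℕ} (hk : k ≤ N) (h : IsCut l k) :
      ∑ i ∈ range k, l' i ≤ ∑ i ∈ range k, l i := by
    have h₁ := sum_uEntry l k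
    have h₂ := sum_uEntry l' k
    have h₃ := hU k hk
    have h₄ := hnonneg k
    rw [h.defect_eq_zero] at h₁
    zify at h₃ ⊢
    push_cast at h₁ h₂
    linarith
  rcases isCut_or hl hN n hn with h | ⟨k, rfl, hkN, h₀, h₂, -, heq⟩
  · exact hcut hn h
  · have e₀ := hcut (by omega) h₀
    have e₂ := hcut (by omega) h₂
    have hmono := hl' k (k + 1) (by omega) hkN
    rw [sum_range_succ, sum_range_succ, sum_range_succ, sum_range_succ] at e₂
    rw [sum_range_succ, sum_range_succ]
    omega

/-- The rank of an entry within its row is the number of smaller entries of the same parity. -/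
lemma card_filter_mvals_of_strictMono {m p q : ℕ} {f g : Fin m → ℕ} (hf : StrictMono f)
    (hfp : ∀ i, f i % 2 = p) (hgq : ∀ i, g i % 2 = q) (hpq : p ≠ q) (i : Fin m) :
    ((mvals f + mvals g).filter fun y => y < f i ∧ y % 2 = f i % 2).card = i := by
  rw [Multiset.filter_add, Multiset.card_add]
  have hg : (mvals g).filter (fun y => y < f i ∧ y % 2 = f i % 2) = 0 := by
    rw [Multiset.filter_eq_nil]
    intro a ha
    obtain ⟨j, -, rfl⟩ := Multiset.mem_map.1 ha
    rintro ⟨-, h⟩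
    rw [hgq, hfp] at h
    exact hpq h.symm
  rw [hg, Multiset.card_zero, add_zero, mvals, Multiset.filter_map, Multiset.card_map]
  change #{j : Fin m | f j < f i ∧ f j % 2 = f i % 2} = i
  simp only [hfp, hf.lt_iff_lt, and_true]
  rw [filter_gt_eq_Iio, Fin.card_Iio]

/-- The u-symbol multiset is the multiset of the `uEntry`s. -/
lemma mvals_xiBar_add_etaBar {m N : ℕ} {l : ℕ → ℕ}
    (hl : ∀ i j, i ≤ j → j < N → l i ≤ l j) {etas xis : Fin m → ℕ}
    (hetas : StrictMono etas) (hxis : StrictMono xis)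
    (hetaseven : ∀ i, Even (etas i)) (hxisodd : ∀ i, Odd (xis i))
    (henum : mvals (fun i : Fin N => l i + (i : ℕ)) = mvals etas + mvals xis) :
    mvals (xiBar xis) + mvals (etaBar etas) = mvals fun i : Fin N => uEntry l i := by
  set L := mvals etas + mvals xis with hL
  let r : ℕ → ℕ := fun x => x / 2 + (L.filter fun y => y < x ∧ y % 2 = x % 2).card
  have h0 (i) : etas i % 2 = 0 := Nat.even_iff.1 (hetaseven i)
  have h1 (i) : xis i % 2 = 1 := Nat.odd_iff.1 (hxisodd i)
  have heta : etaBar etas = r ∘ etas := by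
    funext i
    simp only [etaBar, r, Function.comp, hL]
    rw [card_filter_mvals_of_strictMono hetas h0 h1 (by decide)]
  have hxi : xiBar xis = r ∘ xis := by
    funext i
    simp only [xiBar, r, Function.comp, hL]
    rw [add_comm (mvals etas), card_filter_mvals_of_strictMono hxis h1 h0 (by decide)]
    have := h1 i
    omega
  have hu (i : Fin N) : uEntry l i = r (l i + i) := by
    simp only [uEntry, r]
    congr 1
    rw [← henum, mvals, Multiset.filter_map, Multiset.card_map, parityCount]
    change _ = #{j : Fin N | l j + j < l i + i ∧ (l j + j) % 2 = (l i + i) % 2}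
    symm
    refine card_bij (fun j _ => (j : ℕ)) ?_ (fun _ _ _ _ h => Fin.ext h) ?_
    · intro j hj
      simp only [mem_filter, mem_univ, true_and, mem_range] at hj ⊢
      refine ⟨?_, hj.2⟩
      by_contra! hij
      have := hl i j hij j.2
      omega
    · intro j hj
      simp only [mem_filter, mem_range] at hj
      have := hl j i hj.1.le i.2
      refine ⟨⟨j, hj.1.trans i.2⟩, ?_, rfl⟩
      simp only [mem_filter, mem_univ, true_and]
      exact ⟨by omega, hj.2⟩
  have hmap : mvals (fun i : Fin N => uEntry l i) = L.map r := by
    rw [← henum, mvals, mvals, Multiset.map_map]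
    exact Multiset.map_congr rfl fun i _ => hu i
  rw [hmap, heta, hxi, hL, Multiset.map_add, add_comm]
  simp only [mvals, Multiset.map_map]

/-- A strictly increasing family is determined by its multiset of values. -/
lemma eq_of_mvals_eq {m : ℕ} {f g : Fin m → ℕ} (hf : StrictMono f) (hg : StrictMono g)
    (h : mvals f = mvals g) : f = g := by
  refine (hf.range_inj hg).1 ?_
  ext x
  have : x ∈ mvals f ↔ x ∈ mvals g := by rw [h]
  simpa [mvals] using this

lemma filter_mvals_add {m p q : ℕ} {f g : Fin m → ℕ}
    (hfp : ∀ i, f i % 2 = p) (hgq : ∀ i, g i % 2 = q) (hpq : p ≠ q) :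
    (mvals f + mvals g).filter (fun y => y % 2 = p) = mvals f := by
  rw [Multiset.filter_add, Multiset.filter_eq_self.2, Multiset.filter_eq_nil.2, add_zero]
  · intro a ha
    obtain ⟨j, -, rfl⟩ := Multiset.mem_map.1 ha
    rw [hgq]
    exact hpq.symm
  · intro a ha
    obtain ⟨j, -, rfl⟩ := Multiset.mem_map.1 ha
    exact hfp j

/-- Extend a finite sequence by zero. -/
def extendZero {N : ℕ} (f : Fin N → ℕ) (i : ℕ) : ℕ :=
  if h : i < N then f ⟨i, h⟩ else 0

@[simp] lemma extendZero_coe {N : ℕ} (f : Fin N → ℕ) (i : Fin N) : extendZero f i = f i := by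
  simp [extendZero]

lemma extendZero_le {N : ℕ} {f : Fin N → ℕ} (hf : Monotone f) (i j : ℕ) (hij : i ≤ j)
    (hj : j < N) : extendZero f i ≤ extendZero f j := by
  simp only [extendZero, hj, hij.trans_lt hj, dif_pos]
  exact hf hij

lemma evenCounts_extendZero {N : ℕ} {f : Fin N → ℕ}
    (hf : ∀ n : ℕ, Even n → Even ((mvals f).count n)) : EvenCounts (extendZero f) N := by
  intro v hv
  convert hf v hv using 1
  rw [mvals, Multiset.count_map]
  change _ = #{j : Fin N | v = f j}
  symm
  refine card_bij (fun j _ => (j : ℕ)) ?_ (fun _ _ _ _ h => Fin.ext h) ?_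
  · intro j hj
    simp only [mem_filter, mem_univ, true_and, mem_range] at hj ⊢
    exact ⟨j.2, by simp [hj]⟩
  · intro j hj
    simp only [mem_filter, mem_range] at hj
    refine ⟨⟨j, hj.1⟩, ?_, rfl⟩
    simpa [extendZero, hj.1] using hj.2.symm

/-- Lemme 3.5 in type D.  Let λ, λ' be monotone D-admissible sequences of
length 2m (m ≥ 1) with equal sums, with λ̄ enumerated by the odd values ξ* and
the even values η*, and similarly for λ'.  If the u-symbol multiset of λ is
dominated by that of λ', then λ is dominated by λ', and strictly so in some
degree unless the two u-symbols coincide. -/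
theorem lemme_ordre_typeD (m : ℕ) (hm : 1 ≤ m) (lam lam' : Fin (2 * m) → ℕ)
    (hmono : Monotone lam) (hmono' : Monotone lam')
    (hadm : ∀ n : ℕ, Even n → Even ((mvals lam).count n))
    (hadm' : ∀ n : ℕ, Even n → Even ((mvals lam').count n))
    (hsum : (mvals lam).sum = (mvals lam').sum)
    (etas : Fin m → ℕ) (xis : Fin m → ℕ)
    (etas' : Fin m → ℕ) (xis' : Fin m → ℕ)
    (hetas : StrictMono etas) (hxis : StrictMono xis)
    (hetas' : StrictMono etas') (hxis' : StrictMono xis')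
    (hetaseven : ∀ i, Even (etas i)) (hxisodd : ∀ i, Odd (xis i))
    (hetaseven' : ∀ i, Even (etas' i)) (hxisodd' : ∀ i, Odd (xis' i))
    (henum : mvals (fun i : Fin (2 * m) => lam i + (i : ℕ)) = mvals etas + mvals xis)
    (henum' : mvals (fun i : Fin (2 * m) => lam' i + (i : ℕ)) = mvals etas' + mvals xis')
    (hdom : ∀ i, sigmaTop (mvals (xiBar xis) + mvals (etaBar etas)) i ≤
      sigmaTop (mvals (xiBar xis') + mvals (etaBar etas')) i) :
    (∀ i, sigmaTop (mvals lam) i ≤ sigmaTop (mvals lam') i) ∧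
      ((xiBar xis, etaBar etas) ≠ (xiBar xis', etaBar etas') →
        ∃ i, sigmaTop (mvals lam) i < sigmaTop (mvals lam') i) := by
  have hl := extendZero_le hmono
  have hl' := extendZero_le hmono'
  have hN := evenCounts_extendZero hadm
  have hN' := evenCounts_extendZero hadm'
  have htop (k : ℕ) : sigmaTop (mvals lam) k + ∑ i ∈ range (2 * m - k), extendZero lam i =
      ∑ i ∈ range (2 * m), extendZero lam i := by
    simpa only [extendZero_coe] using sigmaTop_add_sum_range hl k
  have htop' (k : ℕ) : sigmaTop (mvals lam') k + ∑ i ∈ range (2 * m - k), extendZero lam' i =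
      ∑ i ∈ range (2 * m), extendZero lam' i := by
    simpa only [extendZero_coe] using sigmaTop_add_sum_range hl' k
  have hU := mvals_xiBar_add_etaBar hl hetas hxis hetaseven hxisodd (by simpa using henum)
  have hU' := mvals_xiBar_add_etaBar hl' hetas' hxis' hetaseven' hxisodd' (by simpa using henum')
  have hUtop := sigmaTop_add_sum_range (uEntry_le hl hN)
  have hUtop' := sigmaTop_add_sum_range (uEntry_le hl' hN')
  rw [hU, hU'] at hdom
  have hsumExt (f : Fin (2 * m) → ℕ) : ∑ i ∈ range (2 * m), extendZero f i = (mvals f).sum := by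
    rw [Finset.sum_range]
    simp only [extendZero_coe]
    rfl
  have htotal : ∑ i ∈ range (2 * m), extendZero lam i =
      ∑ i ∈ range (2 * m), extendZero lam' i := by
    rw [hsumExt, hsumExt, hsum]
  have hUtotal : ∑ i ∈ range (2 * m), uEntry (extendZero lam) i =
      ∑ i ∈ range (2 * m), uEntry (extendZero lam') i := by
    have h₁ := sum_uEntry (extendZero lam) (2 * m)
    have h₂ := sum_uEntry (extendZero lam') (2 * m)
    rw [(hN.isCut hl).defect_eq_zero, htotal] at h₁
    rw [(hN'.isCut hl').defect_eq_zero] at h₂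
    omega
  have hprefix := sum_range_le_of_uEntry hl hl' hN (by
    intro n hn
    have h₁ := hUtop (2 * m - n)
    have h₂ := hUtop' (2 * m - n)
    have h₃ := hdom (2 * m - n)
    rw [Nat.sub_sub_self hn] at h₁ h₂
    omega)
  have hle (i : ℕ) : sigmaTop (mvals lam) i ≤ sigmaTop (mvals lam') i := by
    have h₁ := htop i
    have h₂ := htop' i
    have h₃ := hprefix (2 * m - i) (Nat.sub_le _ _)
    omega
  refine ⟨hle, fun hne => ?_⟩
  by_contra! hge
  apply hne
  have hpre (n : ℕ) (hn : n ≤ 2 * m) :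
      ∑ i ∈ range n, extendZero lam i = ∑ i ∈ range n, extendZero lam' i := by
    have h₁ := htop (2 * m - n)
    have h₂ := htop' (2 * m - n)
    have h₃ := (hle (2 * m - n)).antisymm (hge _)
    rw [Nat.sub_sub_self hn] at h₁ h₂
    omega
  have hlam : lam = lam' := by
    funext i
    have h₁ := hpre i i.2.le
    have h₂ := hpre (i + 1) i.2
    rw [sum_range_succ, sum_range_succ, extendZero_coe, extendZero_coe] at h₂
    omega
  subst hlam
  have hadd : mvals etas + mvals xis = mvals etas' + mvals xis' := henum.symm.trans henum'
  have h0 (i) : etas i % 2 = 0 := Nat.even_iff.1 (hetaseven i)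
  have h1 (i) : xis i % 2 = 1 := Nat.odd_iff.1 (hxisodd i)
  have h0' (i) : etas' i % 2 = 0 := Nat.even_iff.1 (hetaseven' i)
  have h1' (i) : xis' i % 2 = 1 := Nat.odd_iff.1 (hxisodd' i)
  have heta : mvals etas = mvals etas' := by
    rw [← filter_mvals_add h0 h1 (by decide), hadd, filter_mvals_add h0' h1' (by decide)]
  have hxi : mvals xis = mvals xis' := by
    rw [heta] at hadd
    exact add_left_cancel hadd
  rw [eq_of_mvals_eq hetas hetas' heta, eq_of_mvals_eq hxis hxis' hxi]
end

section
/- Let μ and ν be multisets of natural numbers with the same cardinality and the same total sum such that σ_i(μ) ≤ σ_i(ν) for all i. Then there exist a natural number s and a sequence of multisets τ_0 = μ, τ_1, …, τ_s = ν, all of the same cardinality and the same total sum, such that for each j one has σ_i(τ_j) ≤ σ_i(τ_{j+1}) for all i, and τ_j and τ_{j+1} differ in at most two elements (i.e. the multiset difference τ_{j+1} − τ_j has cardinality at most 2). (This is the chain of intermediate u-symbols, consecutive ones differing in at most two entries, used in the proof of Lemme 3.5 of the paper.) -/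
theorem List.sum_take_le_mul_add_sum_map_sub (t : ℕ) (l : List ℕ) (i : ℕ) :
    (l.take i).sum ≤ i * t + (l.map (· - t)).sum := by
  induction l generalizing i with
  | nil => simp
  | cons x l ih =>
    cases i with
    | zero => simp
    | succ i =>
      have := ih i
      simp only [List.take_succ_cons, List.sum_cons, List.map_cons, Nat.succ_mul]
      omega

theorem List.exists_sum_take_eq_of_threshold (t : ℕ) (l : List ℕ)
    (hl : l.Pairwise (· ≥ ·)) :
    ∃ i, (l.take i).sum = i * t + (l.map (· - t)).sum := by
  induction l with
  | nil => exact ⟨0, by simp⟩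
  | cons x l ih =>
    rw [List.pairwise_cons] at hl
    by_cases hx : t ≤ x
    · obtain ⟨i, hi⟩ := ih hl.2
      refine ⟨i + 1, ?_⟩
      simp only [List.take_succ_cons, List.sum_cons, List.map_cons, Nat.succ_mul]
      omega
    · refine ⟨0, ?_⟩
      symm
      simp only [List.take_zero, List.sum_nil, Nat.zero_mul, Nat.zero_add, List.sum_eq_zero_iff,
        List.mem_map, List.mem_cons]
      rintro y ⟨z, rfl | hz, rfl⟩
      · omega
      · have := hl.1 z hz
        omega

theorem List.exists_sum_take_eq_of_index (l : List ℕ) (hl : l.Pairwise (· ≥ ·)) (i : ℕ) :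
    ∃ t, (t ∈ l ∨ t = 0) ∧ (l.take i).sum = i * t + (l.map (· - t)).sum := by
  induction l generalizing i with
  | nil => exact ⟨0, by simp⟩
  | cons x l ih =>
    rw [List.pairwise_cons] at hl
    cases i with
    | zero =>
      refine ⟨x, by simp, ?_⟩
      symm
      simp only [List.take_zero, List.sum_nil, Nat.zero_mul, Nat.zero_add, List.sum_eq_zero_iff,
        List.mem_map, List.mem_cons]
      rintro y ⟨z, rfl | hz, rfl⟩
      · omega
      · have := hl.1 z hz
        omega
    | succ i =>
      obtain ⟨t, ht, hi⟩ := ih hl.2 i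
      have htx : t ≤ x := by
        rcases ht with ht | rfl
        · exact hl.1 t ht
        · exact Nat.zero_le x
      refine ⟨t, ht.imp_left (List.mem_cons_of_mem x), ?_⟩
      simp only [List.take_succ_cons, List.sum_cons, List.map_cons, Nat.succ_mul]
      omega

/-- The total excess of the elements of `μ` over the threshold `t`. -/
def excess (μ : Multiset ℕ) (t : ℕ) : ℕ :=
  (μ.map (· - t)).sum

@[simp]
theorem excess_cons (a : ℕ) (μ : Multiset ℕ) (t : ℕ) :
    excess (a ::ₘ μ) t = (a - t) + excess μ t := by
  simp [excess]

@[simp]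
theorem excess_zero_right (μ : Multiset ℕ) : excess μ 0 = μ.sum := by
  simp [excess]

theorem excess_eq_zero_iff {μ : Multiset ℕ} {t : ℕ} : excess μ t = 0 ↔ ∀ x ∈ μ, x ≤ t := by
  simp [excess, Multiset.sum_eq_zero_iff, Nat.sub_eq_zero_iff_le]

theorem excess_eq_sum_map_reverse_sort (μ : Multiset ℕ) (t : ℕ) :
    excess μ t = ((μ.sort (· ≤ ·)).reverse.map (· - t)).sum := by
  conv_lhs => rw [← Multiset.sort_eq μ (· ≤ ·)]
  rw [List.map_reverse, List.sum_reverse, excess, Multiset.map_coe, Multiset.sum_coe]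

theorem pairwise_reverse_sort (μ : Multiset ℕ) :
    (μ.sort (· ≤ ·)).reverse.Pairwise (· ≥ ·) :=
  List.pairwise_reverse.2 (Multiset.pairwise_sort μ (· ≤ ·))

theorem sigmaTop_le (μ : Multiset ℕ) (i t : ℕ) : sigmaTop μ i ≤ i * t + excess μ t := by
  rw [excess_eq_sum_map_reverse_sort]
  exact List.sum_take_le_mul_add_sum_map_sub t _ i

theorem forall_sigmaTop_le_iff_forall_excess_le {μ ν : Multiset ℕ} :
    (∀ i, sigmaTop μ i ≤ sigmaTop ν i) ↔ ∀ t, excess μ t ≤ excess ν t := by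
  constructor
  · intro h t
    obtain ⟨i, hi⟩ := List.exists_sum_take_eq_of_threshold t _ (pairwise_reverse_sort μ)
    rw [← excess_eq_sum_map_reverse_sort] at hi
    change sigmaTop μ i = _ at hi
    have := h i
    have := sigmaTop_le ν i t
    omega
  · intro h i
    obtain ⟨t, -, ht⟩ := List.exists_sum_take_eq_of_index _ (pairwise_reverse_sort ν) i
    rw [← excess_eq_sum_map_reverse_sort] at ht
    change sigmaTop ν i = _ at ht
    have := h t
    have := sigmaTop_le μ i t
    omega

/-- One step of a dominance chain: cardinality and sum are preserved, the dominance order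
increases, and at most two elements change. -/
structure DominanceStep (μ ν : Multiset ℕ) : Prop where
  card_eq : Multiset.card ν = Multiset.card μ
  sum_eq : ν.sum = μ.sum
  excess_le : ∀ t, excess μ t ≤ excess ν t
  card_sub_le : Multiset.card (ν - μ) ≤ 2

theorem DominanceStep.cons {μ ν : Multiset ℕ} (h : DominanceStep μ ν) (x : ℕ) :
    DominanceStep (x ::ₘ μ) (x ::ₘ ν) where
  card_eq := by simp [h.card_eq]
  sum_eq := by simp [h.sum_eq]
  excess_le t := by simpa using h.excess_le t
  card_sub_le := by
    rw [← Multiset.singleton_add, ← Multiset.singleton_add, add_tsub_add_eq_tsub_left]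
    exact h.card_sub_le

theorem excess_spread (a b : ℕ) (μ : Multiset ℕ) (hba : b ≤ a) (t : ℕ) :
    excess ((a + 1) ::ₘ (b - 1) ::ₘ μ) t =
      excess (a ::ₘ b ::ₘ μ) t + if b ≤ t ∧ t ≤ a then 1 else 0 := by
  simp only [excess_cons]
  split_ifs <;> omega

theorem dominanceStep_spread (a b : ℕ) (μ : Multiset ℕ) (hb : 0 < b) (hba : b ≤ a) :
    DominanceStep (a ::ₘ b ::ₘ μ) ((a + 1) ::ₘ (b - 1) ::ₘ μ) where
  card_eq := by simp
  sum_eq := by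
    simp only [Multiset.sum_cons]
    omega
  excess_le t := by
    rw [excess_spread a b μ hba]
    exact Nat.le_add_right _ _
  card_sub_le := by
    have h : (a + 1) ::ₘ (b - 1) ::ₘ μ - (a ::ₘ b ::ₘ μ) ≤ {a + 1, b - 1} := by
      rw [tsub_le_iff_right]
      simp only [Multiset.insert_eq_cons, Multiset.cons_add, Multiset.singleton_add,
        Multiset.cons_le_cons_iff]
      exact (Multiset.le_cons_self μ b).trans (Multiset.le_cons_self _ a)
    simpa using Multiset.card_le_card h

/-- If `a ::ₘ μ` is dominated by `M ::ₘ ν` and `a < M`, then the entry `a` can be raised by one, at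
the expense of an element `b` of `μ`, while staying below `M ::ₘ ν`. -/
theorem exists_excess_lt {a M : ℕ} {μ ν : Multiset ℕ} (haM : a < M)
    (hsum : (a ::ₘ μ).sum = (M ::ₘ ν).sum)
    (hdom : ∀ t, excess (a ::ₘ μ) t ≤ excess (M ::ₘ ν) t) :
    ∃ b ∈ μ, 0 < b ∧ ∀ t, b ≤ t → t ≤ a → excess (a ::ₘ μ) t < excess (M ::ₘ ν) t := by
  let P : ℕ → Prop := fun t => excess (a ::ₘ μ) t = excess (M ::ₘ ν) t
  have hP0 : P 0 := by simpa [P] using hsum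
  have hex : ∃ p ≤ a, P p ∧ ∀ t, p < t → t ≤ a → ¬ P t := by
    classical
    exact ⟨Nat.findGreatest P a, Nat.findGreatest_le a,
      Nat.findGreatest_spec (Nat.zero_le a) hP0,
      fun t h1 h2 => Nat.findGreatest_is_greatest h1 h2⟩
  obtain ⟨p, hpa, hp, hgt⟩ := hex
  have hb : ∃ b ∈ μ, p < b := by
    by_contra! h
    have h0 := excess_eq_zero_iff.2 h
    simp only [P, excess_cons] at hp
    omega
  obtain ⟨b, hbμ, hpb⟩ := hb
  exact ⟨b, hbμ, by omega, fun t h1 h2 => lt_of_le_of_ne (hdom t) (hgt t (by omega) h2)⟩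

theorem Multiset.exists_eq_cons_max {μ : Multiset ℕ} (h : μ ≠ 0) :
    ∃ a μ', μ = a ::ₘ μ' ∧ ∀ x ∈ μ', x ≤ a := by
  obtain ⟨a, ha, hmax⟩ := Multiset.exists_max_image id h
  exact ⟨a, μ.erase a, (Multiset.cons_erase ha).symm,
    fun x hx => hmax x (Multiset.mem_of_mem_erase hx)⟩

theorem reflTransGen_dominanceStep {μ ν : Multiset ℕ}
    (hcard : Multiset.card μ = Multiset.card ν) (hsum : μ.sum = ν.sum)
    (hdom : ∀ t, excess μ t ≤ excess ν t) : Relation.ReflTransGen DominanceStep μ ν := by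
  induction hn : Multiset.card ν generalizing μ ν with
  | zero =>
    rw [hn] at hcard
    rw [Multiset.card_eq_zero.1 hn, Multiset.card_eq_zero.1 hcard]
  | succ n ih =>
    obtain ⟨M, ν, rfl, hν⟩ := Multiset.exists_eq_cons_max (μ := ν) (by rintro rfl; simp at hn)
    obtain ⟨a, μ, rfl, hμ⟩ :=
      Multiset.exists_eq_cons_max (μ := μ) (by rintro rfl; simp at hcard)
    have haM : a ≤ M := by
      have h := hdom M
      have h0 : excess (M ::ₘ ν) M = 0 := excess_eq_zero_iff.2 (by simpa using hν)
      rw [h0, Nat.le_zero, excess_eq_zero_iff] at h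
      exact h a (Multiset.mem_cons_self a μ)
    induction hk : M - a generalizing a μ with
    | zero =>
      obtain rfl : a = M := by omega
      exact (ih (by simpa using hcard) (by simpa using hsum) (by simpa using hdom)
        (by simpa using hn)).lift (a ::ₘ ·) fun _ _ h => h.cons a
    | succ k ihk =>
      obtain ⟨b, hbμ, hb, hlt⟩ := exists_excess_lt (by omega) hsum hdom
      obtain ⟨μ, rfl⟩ := Multiset.exists_cons_of_mem hbμ
      have hba : b ≤ a := hμ b hbμ
      have hstep := dominanceStep_spread a b μ hb hba
      refine .head hstep (ihk (a + 1) ((b - 1) ::ₘ μ) (fun x hx => ?_)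
        (hstep.card_eq.trans hcard) (hstep.sum_eq.trans hsum) (fun t => ?_) (by omega) (by omega))
      · rcases Multiset.mem_cons.1 hx with rfl | hx
        · omega
        · exact (hμ x (Multiset.mem_cons_of_mem hx)).trans a.le_succ
      · rw [excess_spread a b μ hba]
        split_ifs with ht
        · exact hlt t ht.1 ht.2
        · exact hdom t

theorem Relation.ReflTransGen.exists_seq {α : Type*} {r : α → α → Prop} {x y : α}
    (h : Relation.ReflTransGen r x y) :
    ∃ (s : ℕ) (f : ℕ → α), f 0 = x ∧ f s = y ∧ ∀ j < s, r (f j) (f (j + 1)) := by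
  induction h using Relation.ReflTransGen.head_induction_on with
  | refl => exact ⟨0, fun _ => y, rfl, rfl, by simp⟩
  | @head a b hab _ ih =>
    obtain ⟨s, f, h0, hs, hf⟩ := ih
    refine ⟨s + 1, fun j => Nat.casesOn j a f, rfl, hs, fun j hj => ?_⟩
    cases j with
    | zero => simpa [h0] using hab
    | succ j => exact hf j (by omega)

/-- If `μ ⊴ ν` in the dominance order (same cardinality, same sum), then there
is a chain of intermediate multisets from `μ` to `ν`, all of the same
cardinality and total sum, increasing in the dominance order, in which
consecutive multisets differ in at most two elements. -/
theorem dominance_chain (μ ν : Multiset ℕ)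
    (hcard : Multiset.card μ = Multiset.card ν) (hsum : μ.sum = ν.sum)
    (hdom : ∀ i, sigmaTop μ i ≤ sigmaTop ν i) :
    ∃ (s : ℕ) (τ : ℕ → Multiset ℕ), τ 0 = μ ∧ τ s = ν ∧
      (∀ j ≤ s, Multiset.card (τ j) = Multiset.card μ ∧ (τ j).sum = μ.sum) ∧
      (∀ j < s, (∀ i, sigmaTop (τ j) i ≤ sigmaTop (τ (j + 1)) i) ∧
        Multiset.card (τ (j + 1) - τ j) ≤ 2) := by
  obtain ⟨s, τ, h0, hs, hτ⟩ := (reflTransGen_dominanceStep hcard hsum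
    (forall_sigmaTop_le_iff_forall_excess_le.1 hdom)).exists_seq
  refine ⟨s, τ, h0, hs, fun j hj => ?_, fun j hj =>
    ⟨forall_sigmaTop_le_iff_forall_excess_le.2 (hτ j hj).excess_le, (hτ j hj).card_sub_le⟩⟩
  induction j with
  | zero => simp [h0]
  | succ j ih =>
    have hstep := hτ j hj
    exact ⟨hstep.card_eq.trans (ih (by omega)).1, hstep.sum_eq.trans (ih (by omega)).2⟩
end
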